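/- Let A : ℝ^{n₁×n₂} → ℝ^m be a linear measurement operator, y ∈ ℝ^m, and α₁, α₂, β₁, β₂ > 0. Let (U_k, V_k)_{k≥0} be generated by alternating minimization of J, i.e. U_{k+1} minimizes U ↦ J(U, V_k) over ℝ^{n₁×R} and V_{k+1} minimizes V ↦ J(U_{k+1}, V) over ℝ^{n₂×R}. Then the series Σ_{k=0}^∞ ( ‖U_k − U_{k+1}‖_F² + ‖V_k − V_{k+1}‖_F² ) converges, with sum at most J(U₀, V₀)/min{α₁, β₁}; in particular ‖U_k − U_{k+1}‖_F² + ‖V_k − V_{k+1}‖_F² → 0 as k → ∞. -/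

import Mathlib

open MeasureTheory ProbabilityTheory Filter Matrix Pointwise

noncomputable section

/-- Measurable space structure on matrices (entrywise product σ-algebra). -/
instance {m n α : Type*} [MeasurableSpace α] : MeasurableSpace (Matrix m n α) :=
  MeasurableSpace.pi (m := fun _ : m => MeasurableSpace.pi (m := fun _ : n => inferInstance))

/-- Frobenius inner product of two real matrices. -/
def frob {n₁ n₂ : ℕ} (A B : Matrix (Fin n₁) (Fin n₂) ℝ) : ℝ :=
  ∑ i, ∑ j, A i j * B i j

/-- Frobenius norm of a real matrix. -/
def frobNorm {n₁ n₂ : ℕ} (A : Matrix (Fin n₁) (Fin n₂) ℝ) : ℝ :=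
  Real.sqrt (∑ i, ∑ j, A i j ^ 2)

/-- Entrywise ℓ¹-norm of a real matrix. -/
def l1Norm {n₁ n₂ : ℕ} (A : Matrix (Fin n₁) (Fin n₂) ℝ) : ℝ :=
  ∑ i, ∑ j, |A i j|

/-- Euclidean (ℓ²) norm of a vector in ℝ^m. -/
def l2Norm {m : ℕ} (y : Fin m → ℝ) : ℝ :=
  Real.sqrt (∑ i, y i ^ 2)

/-- The linear measurement operator `A(Z)ᵢ = (1/√m)·⟨Aᵢ, Z⟩_F` determined by matrices `A i`. -/
def measOp {n₁ n₂ m : ℕ} (A : Fin m → Matrix (Fin n₁) (Fin n₂) ℝ)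
    (Z : Matrix (Fin n₁) (Fin n₂) ℝ) : Fin m → ℝ :=
  fun i => (1 / Real.sqrt m) * frob (A i) Z

/-- The multi-penalty functional
`J(U,V) = ‖y − A(UVᵀ)‖₂² + α₁‖U‖_F² + α₂‖U‖₁ + β₁‖V‖_F² + β₂‖V‖₁`. -/
def Jfun {n₁ n₂ m R : ℕ} (A : Fin m → Matrix (Fin n₁) (Fin n₂) ℝ) (y : Fin m → ℝ)
    (α₁ α₂ β₁ β₂ : ℝ) (U : Matrix (Fin n₁) (Fin R) ℝ) (V : Matrix (Fin n₂) (Fin R) ℝ) : ℝ :=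
  l2Norm (fun i => y i - measOp A (U * Vᵀ) i) ^ 2 + α₁ * frobNorm U ^ 2 + α₂ * l1Norm U
    + β₁ * frobNorm V ^ 2 + β₂ * l1Norm V

/-- The signal set `K_{s₁,s₂}^R` of matrices `Z = UVᵀ` with
`max{‖U‖_F², ‖V‖_F²} ≤ R`, `‖U‖₁ ≤ R√s₁`, `‖V‖₁ ≤ R√s₂`. -/
def Kset (n₁ n₂ : ℕ) (R : ℕ) (s₁ s₂ : ℝ) : Set (Matrix (Fin n₁) (Fin n₂) ℝ) :=
  {Z | ∃ (U : Matrix (Fin n₁) (Fin R) ℝ) (V : Matrix (Fin n₂) (Fin R) ℝ),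
    Z = U * Vᵀ ∧ max (frobNorm U ^ 2) (frobNorm V ^ 2) ≤ (R : ℝ) ∧
    l1Norm U ≤ (R : ℝ) * Real.sqrt s₁ ∧ l1Norm V ≤ (R : ℝ) * Real.sqrt s₂}

lemma frobNorm_sq {n₁ n₂ : ℕ} (P : Matrix (Fin n₁) (Fin n₂) ℝ) :
    frobNorm P ^ 2 = ∑ i, ∑ j, P i j ^ 2 :=
  Real.sq_sqrt (Finset.sum_nonneg fun _ _ => Finset.sum_nonneg fun _ _ => sq_nonneg _)

lemma frobNorm_sq_convexCombo {n₁ n₂ : ℕ} (P Q : Matrix (Fin n₁) (Fin n₂) ℝ) (t : ℝ) :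
    frobNorm ((1 - t) • P + t • Q) ^ 2 =
      (1 - t) * frobNorm P ^ 2 + t * frobNorm Q ^ 2 - t * (1 - t) * frobNorm (Q - P) ^ 2 := by
  simp only [frobNorm_sq, Finset.mul_sum, ← Finset.sum_add_distrib, ← Finset.sum_sub_distrib]
  refine Finset.sum_congr rfl fun i _ => Finset.sum_congr rfl fun j _ => ?_
  simp only [Matrix.add_apply, Matrix.sub_apply, Matrix.smul_apply, smul_eq_mul]
  ring

lemma l1Norm_nonneg {n₁ n₂ : ℕ} (P : Matrix (Fin n₁) (Fin n₂) ℝ) : 0 ≤ l1Norm P :=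
  Finset.sum_nonneg fun _ _ => Finset.sum_nonneg fun _ _ => abs_nonneg _

lemma l1Norm_convexCombo_le {n₁ n₂ : ℕ} (P Q : Matrix (Fin n₁) (Fin n₂) ℝ) {t : ℝ}
    (h0 : 0 ≤ t) (h1 : t ≤ 1) :
    l1Norm ((1 - t) • P + t • Q) ≤ (1 - t) * l1Norm P + t * l1Norm Q := by
  simp only [l1Norm, Finset.mul_sum, ← Finset.sum_add_distrib]
  refine Finset.sum_le_sum fun i _ => Finset.sum_le_sum fun j _ => ?_
  simp only [Matrix.add_apply, Matrix.smul_apply, smul_eq_mul]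
  refine (abs_add_le _ _).trans_eq ?_
  rw [abs_mul, abs_mul, abs_of_nonneg h0, abs_of_nonneg (sub_nonneg.2 h1)]

lemma measOp_convexCombo {n₁ n₂ m : ℕ} (A : Fin m → Matrix (Fin n₁) (Fin n₂) ℝ)
    (P Q : Matrix (Fin n₁) (Fin n₂) ℝ) (t : ℝ) (i : Fin m) :
    measOp A ((1 - t) • P + t • Q) i = (1 - t) * measOp A P i + t * measOp A Q i := by
  have h : frob (A i) ((1 - t) • P + t • Q) =
      (1 - t) * frob (A i) P + t * frob (A i) Q := by
    simp only [frob, Finset.mul_sum, ← Finset.sum_add_distrib]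
    refine Finset.sum_congr rfl fun k _ => Finset.sum_congr rfl fun j _ => ?_
    simp only [Matrix.add_apply, Matrix.smul_apply, smul_eq_mul]
    ring
  simp only [measOp, h]
  ring

lemma residual_sq_convexCombo_le {n₁ n₂ m : ℕ} (A : Fin m → Matrix (Fin n₁) (Fin n₂) ℝ)
    (y : Fin m → ℝ) (P Q : Matrix (Fin n₁) (Fin n₂) ℝ) {t : ℝ} (h0 : 0 ≤ t) (h1 : t ≤ 1) :
    l2Norm (fun i => y i - measOp A ((1 - t) • P + t • Q) i) ^ 2 ≤
      (1 - t) * l2Norm (fun i => y i - measOp A P i) ^ 2 +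
        t * l2Norm (fun i => y i - measOp A Q i) ^ 2 := by
  have hsq (v : Fin m → ℝ) : l2Norm v ^ 2 = ∑ i, v i ^ 2 :=
    Real.sq_sqrt (Finset.sum_nonneg fun _ _ => sq_nonneg _)
  simp only [hsq, measOp_convexCombo, Finset.mul_sum, ← Finset.sum_add_distrib]
  refine Finset.sum_le_sum fun i _ => ?_
  nlinarith [mul_nonneg (mul_nonneg h0 (sub_nonneg.2 h1))
    (sq_nonneg (measOp A P i - measOp A Q i))]

lemma Jfun_nonneg {n₁ n₂ m R : ℕ} (A : Fin m → Matrix (Fin n₁) (Fin n₂) ℝ) (y : Fin m → ℝ)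
    {α₁ α₂ β₁ β₂ : ℝ} (hα₁ : 0 ≤ α₁) (hα₂ : 0 ≤ α₂) (hβ₁ : 0 ≤ β₁) (hβ₂ : 0 ≤ β₂)
    (U : Matrix (Fin n₁) (Fin R) ℝ) (V : Matrix (Fin n₂) (Fin R) ℝ) :
    0 ≤ Jfun A y α₁ α₂ β₁ β₂ U V := by
  have hU := l1Norm_nonneg U
  have hV := l1Norm_nonneg V
  unfold Jfun
  positivity

/-- Strong convexity of `J` in its first argument. -/
lemma Jfun_convexCombo_left_le {n₁ n₂ m R : ℕ} (A : Fin m → Matrix (Fin n₁) (Fin n₂) ℝ)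
    (y : Fin m → ℝ) (α₁ : ℝ) {α₂ : ℝ} (β₁ β₂ : ℝ) (hα₂ : 0 ≤ α₂)
    (P Q : Matrix (Fin n₁) (Fin R) ℝ) (V : Matrix (Fin n₂) (Fin R) ℝ) {t : ℝ}
    (h0 : 0 ≤ t) (h1 : t ≤ 1) :
    Jfun A y α₁ α₂ β₁ β₂ ((1 - t) • P + t • Q) V ≤
      (1 - t) * Jfun A y α₁ α₂ β₁ β₂ P V + t * Jfun A y α₁ α₂ β₁ β₂ Q V
        - t * (1 - t) * (α₁ * frobNorm (Q - P) ^ 2) := by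
  have hres := residual_sq_convexCombo_le A y (P * Vᵀ) (Q * Vᵀ) h0 h1
  have hl1 := mul_le_mul_of_nonneg_left (l1Norm_convexCombo_le P Q h0 h1) hα₂
  simp only [Jfun, Matrix.add_mul, Matrix.smul_mul, frobNorm_sq_convexCombo]
  linarith

/-- Strong convexity of `J` in its second argument. -/
lemma Jfun_convexCombo_right_le {n₁ n₂ m R : ℕ} (A : Fin m → Matrix (Fin n₁) (Fin n₂) ℝ)
    (y : Fin m → ℝ) (α₁ α₂ β₁ : ℝ) {β₂ : ℝ} (hβ₂ : 0 ≤ β₂)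
    (U : Matrix (Fin n₁) (Fin R) ℝ) (P Q : Matrix (Fin n₂) (Fin R) ℝ) {t : ℝ}
    (h0 : 0 ≤ t) (h1 : t ≤ 1) :
    Jfun A y α₁ α₂ β₁ β₂ U ((1 - t) • P + t • Q) ≤
      (1 - t) * Jfun A y α₁ α₂ β₁ β₂ U P + t * Jfun A y α₁ α₂ β₁ β₂ U Q
        - t * (1 - t) * (β₁ * frobNorm (Q - P) ^ 2) := by
  have hres := residual_sq_convexCombo_le A y (U * Pᵀ) (U * Qᵀ) h0 h1
  have hl1 := mul_le_mul_of_nonneg_left (l1Norm_convexCombo_le P Q h0 h1) hβ₂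
  simp only [Jfun, Matrix.transpose_add, Matrix.transpose_smul, Matrix.mul_add, Matrix.mul_smul,
    frobNorm_sq_convexCombo]
  linarith

lemma add_le_of_forall_le_convexCombo_sub {a b K : ℝ}
    (h : ∀ t : ℝ, 0 < t → t < 1 → a ≤ (1 - t) * a + t * b - t * (1 - t) * K) :
    a + K ≤ b := by
  have hlim : Tendsto (fun t : ℝ => a + (1 - t) * K) (nhdsWithin 0 (Set.Ioi 0))
      (nhds (a + K)) := by
    have hc : Continuous fun t : ℝ => a + (1 - t) * K := by fun_prop
    simpa using (hc.tendsto 0).mono_left nhdsWithin_le_nhds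
  refine le_of_tendsto hlim ?_
  filter_upwards [Ioo_mem_nhdsGT (zero_lt_one' ℝ)] with t ht
  refine le_of_mul_le_mul_left ?_ ht.1
  linarith [h t ht.1 ht.2]

/-- A nonnegative sequence dominated by the decrements of a nonnegative energy is summable, with
sum bounded by the initial energy. -/
lemma summable_and_tsum_le_of_add_mul_le {f E : ℕ → ℝ} {c : ℝ} (hc : 0 < c) (hf : ∀ k, 0 ≤ f k)
    (hE : ∀ k, 0 ≤ E k) (h : ∀ k, E (k + 1) + c * f k ≤ E k) :
    Summable f ∧ ∑' k, f k ≤ E 0 / c := by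
  have hsum (n : ℕ) : E n + c * ∑ k ∈ Finset.range n, f k ≤ E 0 := by
    induction n with
    | zero => simp
    | succ n ih =>
      rw [Finset.sum_range_succ]
      linarith [h n]
  have hbound (n : ℕ) : ∑ k ∈ Finset.range n, f k ≤ E 0 / c := by
    rw [le_div_iff₀' hc]
    linarith [hsum n, hE n]
  exact ⟨summable_of_sum_range_le hf hbound, Real.tsum_le_of_sum_range_le hf hbound⟩

/-- square-summability of the alternating-minimization increments. -/
theorem alternating_minimization_summable {n₁ n₂ m R : ℕ}
    (A : Fin m → Matrix (Fin n₁) (Fin n₂) ℝ) (y : Fin m → ℝ)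
    (α₁ α₂ β₁ β₂ : ℝ) (hα₁ : 0 < α₁) (hα₂ : 0 < α₂) (hβ₁ : 0 < β₁) (hβ₂ : 0 < β₂)
    (U : ℕ → Matrix (Fin n₁) (Fin R) ℝ) (V : ℕ → Matrix (Fin n₂) (Fin R) ℝ)
    (hU : ∀ k, ∀ U' : Matrix (Fin n₁) (Fin R) ℝ,
      Jfun A y α₁ α₂ β₁ β₂ (U (k + 1)) (V k) ≤ Jfun A y α₁ α₂ β₁ β₂ U' (V k))
    (hV : ∀ k, ∀ V' : Matrix (Fin n₂) (Fin R) ℝ,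
      Jfun A y α₁ α₂ β₁ β₂ (U (k + 1)) (V (k + 1)) ≤ Jfun A y α₁ α₂ β₁ β₂ (U (k + 1)) V') :
    Summable (fun k => frobNorm (U k - U (k + 1)) ^ 2 + frobNorm (V k - V (k + 1)) ^ 2) ∧
    (∑' k : ℕ, (frobNorm (U k - U (k + 1)) ^ 2 + frobNorm (V k - V (k + 1)) ^ 2)) ≤
      Jfun A y α₁ α₂ β₁ β₂ (U 0) (V 0) / min α₁ β₁ ∧
    Tendsto (fun k => frobNorm (U k - U (k + 1)) ^ 2 + frobNorm (V k - V (k + 1)) ^ 2)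
      atTop (nhds 0) := by
  have hdesc (k : ℕ) : Jfun A y α₁ α₂ β₁ β₂ (U (k + 1)) (V (k + 1)) +
      min α₁ β₁ * (frobNorm (U k - U (k + 1)) ^ 2 + frobNorm (V k - V (k + 1)) ^ 2) ≤
      Jfun A y α₁ α₂ β₁ β₂ (U k) (V k) := by
    have hUk := add_le_of_forall_le_convexCombo_sub fun t h0 h1 =>
      (hU k ((1 - t) • U (k + 1) + t • U k)).trans
        (Jfun_convexCombo_left_le A y α₁ β₁ β₂ hα₂.le _ _ _ h0.le h1.le)
    have hVk := add_le_of_forall_le_convexCombo_sub fun t h0 h1 =>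
      (hV k ((1 - t) • V (k + 1) + t • V k)).trans
        (Jfun_convexCombo_right_le A y α₁ α₂ β₁ hβ₂.le _ _ _ h0.le h1.le)
    have hα := mul_le_mul_of_nonneg_right (min_le_left α₁ β₁)
      (sq_nonneg (frobNorm (U k - U (k + 1))))
    have hβ := mul_le_mul_of_nonneg_right (min_le_right α₁ β₁)
      (sq_nonneg (frobNorm (V k - V (k + 1))))
    linarith
  obtain ⟨hs, hle⟩ := summable_and_tsum_le_of_add_mul_le (lt_min hα₁ hβ₁)
    (fun k => add_nonneg (sq_nonneg (frobNorm (U k - U (k + 1))))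
      (sq_nonneg (frobNorm (V k - V (k + 1)))))
    (fun k => Jfun_nonneg A y hα₁.le hα₂.le hβ₁.le hβ₂.le (U k) (V k)) hdesc
  exact ⟨hs, hle, hs.tendsto_atTop_zero⟩
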